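/- For all integers d ≥ 1, A(d) ≤ (10·2^{1/4}·π^{3/4}·e^{−3}) · e^{d²/2 + d} · (2π)^{−d/2} · d^{−d/2 − 1/4}, where A(d) = ∑_{k=0}^{d} P(k) P(d−k). -/

import Mathlib

open Finset Real

/-- `P n = ∏_{j=0}^{n} C(n,j)`. -/
def P (n : ℕ) : ℕ := ∏ j ∈ Finset.range (n + 1), n.choose j

/-- `A d = ∑_{k=0}^{d} P(k) P(d-k)`. -/
def A (d : ℕ) : ℕ := ∑ k ∈ Finset.range (d + 1), P k * P (d - k)

open Filter Topology in
/-- A consequence of Robbins' bounds on the steps of the Stirling sequence: each step is at most two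
thirds of the total remaining decrease towards the limit `√π`. -/
lemma stirlingSeq_log_step_le {n : ℕ} (hn : 2 ≤ n) :
    3 / 2 * (log (Stirling.stirlingSeq n) - log (Stirling.stirlingSeq (n + 1))) ≤
      log (Stirling.stirlingSeq n) - 1 / 2 * log Real.pi := by
  have lower (m : ℕ) : 1 / (3 * (2 * ((m : ℝ) + 1) + 1) ^ 2) ≤
      log (Stirling.stirlingSeq (m + 1)) - log (Stirling.stirlingSeq (m + 2)) := by
    have h := (Stirling.log_stirlingSeq_sdiff_hasSum m).tsum_eq ▸
      (Stirling.log_stirlingSeq_sdiff_hasSum m).summable.le_tsum 0 (fun j _ => by positivity)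
    refine le_trans (le_of_eq ?_) h
    push_cast
    field_simp
    norm_num
  have anti : Antitone fun m : ℕ => 3 / 2 * log (Stirling.stirlingSeq (m + 3)) -
      1 / 2 * log (Stirling.stirlingSeq (m + 2)) := by
    refine antitone_nat_of_succ_le fun m => ?_
    have h1 := lower (m + 2)
    have h2 := Stirling.log_stirlingSeq_sdiff_le (m + 2)
    have h3 : 1 / (12 * ((m + 2 : ℕ) : ℝ) * ((m + 2 : ℕ) + 1)) ≤
        3 * (1 / (3 * (2 * (((m + 2 : ℕ) : ℝ) + 1) + 1) ^ 2)) := by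
      push_cast
      rw [mul_one_div, div_le_div_iff₀ (by positivity) (by positivity)]
      have : (0 : ℝ) ≤ m := m.cast_nonneg
      nlinarith
    simp only [show m + 1 + 3 = m + 2 + 2 by ring, show m + 1 + 2 = m + 2 + 1 by ring] at *
    linarith
  have lim : Tendsto (fun n : ℕ => log (Stirling.stirlingSeq n)) atTop
      (𝓝 (1 / 2 * log Real.pi)) := by
    have h := Stirling.tendsto_stirlingSeq_sqrt_pi.log (by positivity)
    rwa [Real.log_sqrt Real.pi_pos.le, div_eq_inv_mul, ← one_div] at h
  have h := anti.le_of_tendsto (((lim.comp (tendsto_add_atTop_nat 3)).const_mul (3 / 2)).sub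
    ((lim.comp (tendsto_add_atTop_nat 2)).const_mul (1 / 2))) (n - 2)
  simp only [show n - 2 + 3 = n + 1 by omega, show n - 2 + 2 = n by omega] at h
  linarith

lemma P_pos (n : ℕ) : 0 < P n :=
  Finset.prod_pos fun _ hj => Nat.choose_pos (Nat.le_of_lt_succ (Finset.mem_range.1 hj))

lemma P_succ_mul_factorial (n : ℕ) : P (n + 1) * n.factorial = (n + 1) ^ n * P n := by
  have h : P (n + 1) * (n + 1).factorial = (n + 1) ^ (n + 1) * P n := by
    have hf : (n + 1).factorial = ∏ j ∈ Finset.range (n + 1), (n + 1 - j) := by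
      rw [← Finset.prod_range_add_one_eq_factorial, ← Finset.prod_range_reflect]
      refine Finset.prod_congr rfl fun j hj => ?_
      have := Finset.mem_range.1 hj
      omega
    rw [P, Finset.prod_range_succ, Nat.choose_self, mul_one, hf, ← Finset.prod_mul_distrib, P]
    calc _ = ∏ j ∈ Finset.range (n + 1), (n + 1) * n.choose j :=
          Finset.prod_congr rfl fun j _ => by rw [mul_comm (n + 1), Nat.choose_mul_succ_eq]
      _ = _ := by rw [Finset.prod_mul_distrib, Finset.prod_const, Finset.card_range]
  rw [Nat.factorial_succ, pow_succ] at h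
  exact Nat.eq_of_mul_eq_mul_left n.succ_pos (by linarith)

/-- The quotients `P (n + 1) / P n` are increasing. -/
lemma P_succ_mul_P_le {a b : ℕ} (h : a ≤ b) : P (a + 1) * P b ≤ P a * P (b + 1) := by
  induction b, h using Nat.le_induction with
  | base => exact (mul_comm _ _).le
  | succ b _ ih =>
    have hstep : P (b + 1) * P (b + 1) ≤ P b * P (b + 2) := by
      have h1 := P_succ_mul_factorial b
      have h2 := P_succ_mul_factorial (b + 1)
      have h3 : (b + 1) ^ (b + 1) ≤ (b + 2) ^ (b + 1) := Nat.pow_le_pow_left (by omega) _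
      refine Nat.le_of_mul_le_mul_right ?_ (Nat.factorial_pos (b + 1))
      calc P (b + 1) * P (b + 1) * (b + 1).factorial
          = P (b + 1) * ((b + 1) * (P (b + 1) * b.factorial)) := by rw [Nat.factorial_succ]; ring
        _ = (b + 1) ^ (b + 1) * (P b * P (b + 1)) := by rw [h1]; ring
        _ ≤ (b + 2) ^ (b + 1) * (P b * P (b + 1)) := Nat.mul_le_mul_right _ h3
        _ = P b * ((b + 1 + 1) ^ (b + 1) * P (b + 1)) := by ring
        _ = P b * P (b + 2) * (b + 1).factorial := by rw [← h2]; ring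
    refine Nat.le_of_mul_le_mul_right ?_ (P_pos b)
    calc P (a + 1) * P (b + 1) * P b = P (a + 1) * P b * P (b + 1) := by ring
      _ ≤ P a * P (b + 1) * P (b + 1) := Nat.mul_le_mul_right _ ih
      _ = P a * (P (b + 1) * P (b + 1)) := by ring
      _ ≤ P a * (P b * P (b + 2)) := Nat.mul_le_mul_left _ hstep
      _ = P a * P (b + 1 + 1) * P b := by ring

lemma P_succ_mul_P_succ_le (a b : ℕ) : P (a + 1) * P (b + 1) ≤ P (a + b + 1) := by
  induction b with
  | zero => simp [show P 1 = 1 by decide]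
  | succ b ih =>
    have h := P_succ_mul_P_le (show b + 1 ≤ a + b + 1 by omega)
    refine Nat.le_of_mul_le_mul_right ?_ (P_pos (b + 1))
    calc P (a + 1) * P (b + 1 + 1) * P (b + 1)
        = P (a + 1) * P (b + 1) * P (b + 1 + 1) := by ring
      _ ≤ P (a + b + 1) * P (b + 1 + 1) := Nat.mul_le_mul_right _ ih
      _ = P (b + 1 + 1) * P (a + b + 1) := mul_comm _ _
      _ ≤ P (b + 1) * P (a + b + 1 + 1) := h
      _ = P (a + (b + 1) + 1) * P (b + 1) := by rw [mul_comm]; rfl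

lemma two_mul_mul_factorial_le (n : ℕ) : 2 * n * n.factorial ≤ (n + 1) ^ n := by
  rcases n.eq_zero_or_pos with rfl | hn
  · simp
  induction n, hn using Nat.le_induction with
  | base => simp
  | succ n hn ih =>
    have bern : 2 * (n + 1) ^ (n + 1) ≤ (n + 2) ^ (n + 1) := by
      have h := one_add_mul_le_pow (R := ℝ) (a := 1 / ((n : ℝ) + 1))
        (by linarith [show (0 : ℝ) ≤ 1 / ((n : ℝ) + 1) by positivity]) (n + 1)
      have h2 : 1 + 1 / ((n : ℝ) + 1) = (n + 2) / (n + 1) := by field_simp; ring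
      have h3 : 1 + ((n + 1 : ℕ) : ℝ) * (1 / ((n : ℝ) + 1)) = 2 := by push_cast; field_simp; ring
      rw [h2, h3, div_pow, le_div_iff₀ (by positivity)] at h
      exact_mod_cast h
    refine Nat.le_of_mul_le_mul_left ?_ hn
    calc n * (2 * (n + 1) * (n + 1).factorial)
        = 2 * n * n.factorial * (n + 1) ^ 2 := by rw [Nat.factorial_succ]; ring
      _ ≤ (n + 1) ^ n * (n + 1) ^ 2 := Nat.mul_le_mul_right _ ih
      _ = (n + 1) * (n + 1) ^ (n + 1) := by ring
      _ ≤ n * (2 * (n + 1) ^ (n + 1)) := by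
        rw [← mul_assoc]
        exact Nat.mul_le_mul_right _ (by omega)
      _ ≤ n * (n + 1 + 1) ^ (n + 1) := Nat.mul_le_mul_left _ bern

lemma two_mul_A_le {d : ℕ} (hd : 1 ≤ d) : 2 * A d ≤ 5 * P d := by
  obtain ⟨n, rfl⟩ : ∃ n, d = n + 1 := ⟨d - 1, by omega⟩
  have hA : A (n + 1) = (∑ k ∈ Finset.range n, P (k + 1) * P (n - k)) + 2 * P (n + 1) := by
    rw [A, Finset.sum_range_succ, Finset.sum_range_succ']
    simp [P, two_mul, add_assoc]
  have hsum : ∑ k ∈ Finset.range n, P (k + 1) * P (n - k) ≤ n * P n := by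
    refine (Finset.sum_le_card_nsmul _ _ (P n) fun k hk => ?_).trans (by simp)
    have hk := Finset.mem_range.1 hk
    have h := P_succ_mul_P_succ_le k (n - k - 1)
    rwa [show n - k - 1 + 1 = n - k by omega, show k + (n - k - 1) + 1 = n by omega] at h
  have hP : 2 * (n * P n) ≤ P (n + 1) := by
    refine Nat.le_of_mul_le_mul_right ?_ n.factorial_pos
    rw [P_succ_mul_factorial]
    calc 2 * (n * P n) * n.factorial = 2 * n * n.factorial * P n := by ring
      _ ≤ _ := Nat.mul_le_mul_right _ (two_mul_mul_factorial_le n)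
  omega

/-- Logarithm of the upper bound on `A d`. -/
noncomputable def logBound (d : ℝ) : ℝ :=
  log 10 + 1 / 4 * log 2 + 3 / 4 * log Real.pi - 3 + (d ^ 2 / 2 + d)
    - d / 2 * (log 2 + log Real.pi) - (d / 2 + 1 / 4) * log d

lemma bound_eq_exp_logBound {d : ℝ} (hd : 0 < d) :
    (10 * (2 : ℝ) ^ ((1 : ℝ) / 4) * Real.pi ^ ((3 : ℝ) / 4) * Real.exp (-3)) *
      Real.exp (d ^ 2 / 2 + d) * (2 * Real.pi) ^ (-d / 2) * d ^ (-d / 2 - 1 / 4) =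
      Real.exp (logBound d) := by
  have hpi := Real.pi_pos
  rw [Real.rpow_def_of_pos two_pos, Real.rpow_def_of_pos hpi, Real.rpow_def_of_pos hd,
    Real.rpow_def_of_pos (by positivity), Real.log_mul two_ne_zero hpi.ne']
  nth_rw 1 [← Real.exp_log (show (0 : ℝ) < 10 by norm_num)]
  simp only [← Real.exp_add, logBound]
  congr 1
  ring

lemma log_P_succ (n : ℕ) :
    log (P (n + 1)) = log (P n) + n * log (n + 1) - log n.factorial := by
  have h : (P (n + 1) : ℝ) * n.factorial = ((n : ℝ) + 1) ^ n * P n := by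
    exact_mod_cast P_succ_mul_factorial n
  have h1 : (P (n + 1) : ℝ) ≠ 0 := by exact_mod_cast (P_pos _).ne'
  have h2 : (P n : ℝ) ≠ 0 := by exact_mod_cast (P_pos _).ne'
  have h3 : (n.factorial : ℝ) ≠ 0 := by exact_mod_cast n.factorial_ne_zero
  have h4 := congrArg log h
  rw [Real.log_mul h1 h3, Real.log_mul (by positivity) h2, Real.log_pow] at h4
  linarith

lemma log_P_le {d : ℕ} (hd : 2 ≤ d) : log (5 / 2) + log (P d) ≤ logBound d := by
  induction d, hd using Nat.le_induction with
  | base =>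
    have hP : P 2 = 2 := by decide
    have h1 : log (16 * Real.pi) ≤ 4 := by
      rw [Real.log_le_iff_le_exp (by positivity), show (4 : ℝ) = (4 : ℕ) * 1 by norm_num,
        Real.exp_nat_mul]
      calc 16 * Real.pi ≤ 2.7 ^ 4 := by linarith [Real.pi_lt_d2]
        _ ≤ Real.exp 1 ^ 4 := by gcongr; linarith [Real.exp_one_gt_d9]
    rw [Real.log_mul (by norm_num) Real.pi_ne_zero, show (16 : ℝ) = 2 ^ 4 by norm_num,
      Real.log_pow] at h1
    have h10 : log (10 : ℝ) = log 2 + log 5 := by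
      rw [← Real.log_mul (by norm_num) (by norm_num)]; norm_num
    rw [hP, logBound, h10, Real.log_div (by norm_num) (by norm_num)]
    push_cast at h1 ⊢
    linarith
  | succ d hd ih =>
    have hd0 : (d : ℝ) ≠ 0 := by positivity
    have h := stirlingSeq_log_step_le hd
    have h1 := Stirling.log_stirlingSeq_formula d
    have h2 := Stirling.log_stirlingSeq_formula (d + 1)
    rw [Nat.factorial_succ] at h2
    push_cast at h2
    rw [Real.log_mul (by positivity) (by positivity), Real.log_mul (by positivity) (by positivity),
      Real.log_div (by positivity) (by positivity), Real.log_exp] at h2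
    rw [Real.log_mul (by positivity) (by positivity),
      Real.log_div (by positivity) (by positivity), Real.log_exp] at h1
    rw [log_P_succ]
    unfold logBound at *
    push_cast
    linarith

theorem stmt_6 (d : ℕ) (hd : 1 ≤ d) :
    (A d : ℝ) ≤ (10 * (2 : ℝ) ^ ((1 : ℝ) / 4) * Real.pi ^ ((3 : ℝ) / 4) * Real.exp (-3)) *
      Real.exp ((d : ℝ) ^ 2 / 2 + d) * (2 * Real.pi) ^ (-(d : ℝ) / 2) *
      (d : ℝ) ^ (-(d : ℝ) / 2 - 1 / 4) := by
  rw [bound_eq_exp_logBound (by exact_mod_cast hd)]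
  rcases hd.eq_or_lt with rfl | hd
  · have hA : A 1 = 2 := by decide
    have h : 6 + log 2 ≤ 4 * log 5 + log Real.pi := by
      rw [← Real.exp_le_exp, Real.exp_add, Real.exp_add, Real.exp_log two_pos,
        Real.exp_log Real.pi_pos, show 4 * log (5 : ℝ) = log (5 ^ 4) by rw [Real.log_pow]; norm_num,
        Real.exp_log (by norm_num), show (6 : ℝ) = (6 : ℕ) * 1 by norm_num, Real.exp_nat_mul]
      calc Real.exp 1 ^ 6 * 2 ≤ 2.72 ^ 6 * 2 := by gcongr; linarith [Real.exp_one_lt_d9]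
        _ ≤ 5 ^ 4 * Real.pi := by linarith [Real.pi_gt_three]
    have h10 : log (10 : ℝ) = log 2 + log 5 := by
      rw [← Real.log_mul (by norm_num) (by norm_num)]; norm_num
    rw [hA, ← Real.log_le_iff_le_exp (by norm_num), logBound, h10]
    push_cast
    rw [Real.log_one]
    linarith
  · have hP : (0 : ℝ) < P d := by exact_mod_cast P_pos d
    have h : 2 * (A d : ℝ) ≤ 5 * P d := by exact_mod_cast two_mul_A_le (d := d) (by omega)
    calc (A d : ℝ) ≤ 5 / 2 * P d := by linarith
      _ = Real.exp (log (5 / 2) + log (P d)) := by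
        rw [Real.exp_add, Real.exp_log (by norm_num), Real.exp_log hP]
      _ ≤ _ := Real.exp_le_exp.2 (log_P_le hd)
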